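/- arXiv:2406.03335 — 2 statements merged into one kernel-verified Lean document; each statement's English description precedes it below -/
import Mathlib

section
/- Fix c ∈ [1,∞) and A ∈ [1,∞). For a real exponent r ≥ 1 let h_r(x) = (x/a₊)^r, where a₊ = (1 + √c)² (for non-integer exponents the power is applied to the nonnegative quantity Φ_c(x)/a₊ ∈ [0,1] appearing inside Γ_c). Then lim_{k→∞} Γ_c(h_k, h_{Ak}) = (1/(2π²)) ∫₀^∞ ∫₀^∞ ((e^{−s} − e^{−t})/(s − t)) · ((e^{−As} − e^{−At})/(s − t)) · (s + t)/√(st) ds dt, where the limit is over positive integers k. -/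
open MeasureTheory ProbabilityTheory Filter Topology

noncomputable section

/-- The bilinear form `Γ(f,g)` from the paper.  (The integrand is interpreted as `0` on the
measure-zero diagonal `x = y`, since in Lean division by zero yields zero.) -/
def Gam (f g : ℝ → ℝ) : ℝ :=
  (1 / Real.pi ^ 2) *
    ∫ x in (-1 : ℝ)..1, ∫ y in (-1 : ℝ)..1,
      ((f x - f y) / (x - y)) * ((g x - g y) / (x - y)) *
        ((1 - x * y) / (Real.sqrt (1 - x ^ 2) * Real.sqrt (1 - y ^ 2)))

/-- `a₊ = (1 + √c)²`. -/
def aplus (c : ℝ) : ℝ := (1 + Real.sqrt c) ^ 2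

/-- `a₋ = (1 − √c)²`. -/
def aminus (c : ℝ) : ℝ := (1 - Real.sqrt c) ^ 2

/-- `Φ_c(x) = 2√c·x + c + 1`. -/
def PhiC (c : ℝ) (x : ℝ) : ℝ := 2 * Real.sqrt c * x + c + 1

/-- `Γ_c(f,g) = Γ(f ∘ Φ_c, g ∘ Φ_c)`. -/
def GamC (c : ℝ) (f g : ℝ → ℝ) : ℝ := Gam (f ∘ PhiC c) (g ∘ PhiC c)

/-- The integrand `((e^{−s} − e^{−t})/(s − t))·((e^{−As} − e^{−At})/(s − t))·(s + t)/√(st)`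
(interpreted as `0` on the measure-zero diagonal `s = t`, by division-by-zero conventions). -/
def limitKernel (A s t : ℝ) : ℝ :=
  ((Real.exp (-s) - Real.exp (-t)) / (s - t)) *
    ((Real.exp (-(A * s)) - Real.exp (-(A * t))) / (s - t)) *
    ((s + t) / Real.sqrt (s * t))

/-- The approximation `(1 - s / k) ^ k` of `exp (-s)`. -/
def expApprox (k : ℕ) (s : ℝ) : ℝ := (1 - s / k) ^ k

/-- The kernel in the variables `s = N (1 - x)`, `t = N (1 - y)`, before passing to the limit. -/
def prelimitKernel (A N : ℝ) (k : ℕ) (s t : ℝ) : ℝ :=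
  ((expApprox k s - expApprox k t) / (s - t)) *
    ((expApprox k s ^ A - expApprox k t ^ A) / (s - t)) * (2 * (s + t - s * t / N))

theorem integral_eq_integral_cos_mul {l : ℝ} (hl : 0 < l) (F : ℝ → ℝ) :
    ∫ x in (-1 : ℝ)..1, F x =
      ∫ a in Set.Ioo 0 (Real.pi / l), l * Real.sin (l * a) * F (Real.cos (l * a)) := by
  have hmem : ∀ a ∈ Set.Ioo 0 (Real.pi / l), l * a ∈ Set.Ioo 0 Real.pi := by
    rintro a ⟨h0, h1⟩
    exact ⟨by positivity, by rwa [lt_div_iff₀' hl] at h1⟩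
  have hbij : Set.BijOn Real.cos (Set.Ioo 0 Real.pi) (Set.Ioo (-1) 1) :=
    Real.cosPartialHomeomorph.bijOn
  have himg : Set.image (fun a => Real.cos (l * a)) (Set.Ioo 0 (Real.pi / l)) = Set.Ioo (-1) 1 := by
    rw [← hbij.image_eq]
    ext x
    constructor
    · rintro ⟨a, ha, rfl⟩
      exact ⟨_, hmem a ha, rfl⟩
    · rintro ⟨θ, ⟨h0, h1⟩, rfl⟩
      refine ⟨θ / l, ⟨by positivity, by gcongr⟩, ?_⟩
      simp only [mul_div_cancel₀ θ hl.ne']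
  rw [intervalIntegral.integral_of_le (by norm_num), integral_Ioc_eq_integral_Ioo, ← himg,
    integral_image_eq_integral_abs_deriv_smul (f' := fun a => -(l * Real.sin (l * a)))
      measurableSet_Ioo]
  · refine setIntegral_congr_fun measurableSet_Ioo fun a ha => ?_
    have := Real.sin_pos_of_mem_Ioo (hmem a ha)
    simp only [abs_neg, smul_eq_mul]
    rw [abs_of_nonneg (by positivity)]
  · intro a _
    have h := ((hasDerivAt_id a).const_mul l).cos
    simp only [id, mul_one] at h
    exact (h.congr_deriv (by ring)).hasDerivWithinAt
  · intro a ha b hb hab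
    exact mul_left_cancel₀ hl.ne' (hbij.injOn (hmem a ha) (hmem b hb) hab)

theorem integral_Ioi_eq_integral_sq (F : ℝ → ℝ) :
    ∫ s in Set.Ioi (0 : ℝ), F s = ∫ a in Set.Ioi (0 : ℝ), 2 * a * F (a ^ 2) := by
  rw [← integral_comp_rpow_Ioi_of_pos (g := F) (p := 2) two_pos]
  refine setIntegral_congr_fun measurableSet_Ioi fun a _ => ?_
  norm_num

/-- Dominated convergence for iterated integrals. -/
theorem tendsto_integral_integral_of_dominated_convergence {α β : Type*} [MeasurableSpace α]
    [MeasurableSpace β] {μ : Measure α} {ν : Measure β} [SFinite ν]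
    {F : ℕ → α → β → ℝ} {G : α → β → ℝ} {f : α → ℝ} {g : β → ℝ}
    (hF : ∀ n, Measurable (Function.uncurry (F n))) (hf : Integrable f μ) (hg : Integrable g ν)
    (hbound : ∀ᶠ n in atTop, ∀ᵐ a ∂μ, ∀ᵐ b ∂ν, |F n a b| ≤ f a * g b)
    (hlim : ∀ᵐ a ∂μ, ∀ᵐ b ∂ν, Tendsto (fun n => F n a b) atTop (𝓝 (G a b))) :
    Tendsto (fun n => ∫ a, ∫ b, F n a b ∂ν ∂μ) atTop (𝓝 (∫ a, ∫ b, G a b ∂ν ∂μ)) := by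
  obtain ⟨n₀, hn₀⟩ := eventually_atTop.1 hbound
  have hall : ∀ᵐ a ∂μ, ∀ n, n₀ ≤ n → ∀ᵐ b ∂ν, |F n a b| ≤ f a * g b := by
    rw [ae_all_iff]
    intro n
    by_cases hn : n₀ ≤ n
    · filter_upwards [hn₀ n hn] with a ha _ using ha
    · exact Eventually.of_forall fun a h => absurd h hn
  refine tendsto_integral_filter_of_dominated_convergence (fun a => f a * ∫ b, g b ∂ν)
    (Eventually.of_forall fun n =>
      ((hF n).stronglyMeasurable.integral_prod_right (ν := ν)).aestronglyMeasurable)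
    ?_ (hf.mul_const _) ?_
  · filter_upwards [hbound] with n hn
    filter_upwards [hn] with a ha
    rw [← integral_const_mul]
    exact norm_integral_le_of_norm_le (hg.const_mul _) ha
  · filter_upwards [hlim, hall] with a hla hba
    exact tendsto_integral_filter_of_dominated_convergence (fun b => f a * g b)
      (Eventually.of_forall fun n => ((hF n).comp measurable_prodMk_left).aestronglyMeasurable)
      (eventually_atTop.2 ⟨n₀, fun n hn => hba n hn⟩) (hg.const_mul _) hla

theorem abs_rpow_sub_rpow_le {A u v : ℝ} (hA : 1 ≤ A) (hu : 0 ≤ u) (hu1 : u ≤ 1) (hv : 0 ≤ v)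
    (hv1 : v ≤ 1) : |u ^ A - v ^ A| ≤ A * |u - v| := by
  refine (convex_Icc (0 : ℝ) 1).norm_image_sub_le_of_norm_hasDerivWithin_le
    (f := fun x => x ^ A) (f' := fun x => A * x ^ (A - 1)) (C := A) (x := v) (y := u)
    (fun x _ => (Real.hasDerivAt_rpow_const (Or.inr hA)).hasDerivWithinAt) ?_ ⟨hv, hv1⟩ ⟨hu, hu1⟩
  rintro x ⟨hx0, hx1⟩
  have h := Real.rpow_le_one hx0 hx1 (sub_nonneg.2 hA)
  have h0 := Real.rpow_nonneg hx0 (A - 1)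
  rw [Real.norm_eq_abs, abs_of_nonneg (by positivity)]
  nlinarith

theorem one_sub_div_mem_Icc {k : ℕ} {s : ℝ} (hk : 0 < k) (hs : 0 ≤ s) (hsk : s ≤ k) :
    1 - s / k ∈ Set.Icc (0 : ℝ) 1 := by
  have hk' : (0 : ℝ) < k := by exact_mod_cast hk
  have h1 : s / k ≤ 1 := (div_le_one hk').2 hsk
  have h2 : 0 ≤ s / k := by positivity
  exact ⟨by linarith, by linarith⟩

theorem expApprox_nonneg {k : ℕ} {s : ℝ} (hk : 0 < k) (hs : 0 ≤ s) (hsk : s ≤ k) :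
    0 ≤ expApprox k s := pow_nonneg (one_sub_div_mem_Icc hk hs hsk).1 _

theorem expApprox_le_one {k : ℕ} {s : ℝ} (hk : 0 < k) (hs : 0 ≤ s) (hsk : s ≤ k) :
    expApprox k s ≤ 1 :=
  pow_le_one₀ (one_sub_div_mem_Icc hk hs hsk).1 (one_sub_div_mem_Icc hk hs hsk).2

theorem expApprox_sub_le {k : ℕ} {s t : ℝ} (hk : 2 ≤ k) (hs : 0 ≤ s) (hst : s < t) (htk : t ≤ k) :
    (1 + s) * (1 + t) * |expApprox k s - expApprox k t| ≤ 8 * (t - s) := by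
  have hk0 : 0 < k := by omega
  have hk' : (2 : ℝ) ≤ k := by exact_mod_cast hk
  have hkpos : (0 : ℝ) < k := by linarith
  have hu := one_sub_div_mem_Icc hk0 hs (hst.le.trans htk)
  have hv := one_sub_div_mem_Icc hk0 (hs.trans hst.le) htk
  have hvu : 1 - t / k ≤ 1 - s / (k : ℝ) := by gcongr
  have hVU : expApprox k t ≤ expApprox k s := pow_le_pow_left₀ hv.1 hvu _
  rw [abs_of_nonneg (sub_nonneg.2 hVU)]
  have hE : (1 + s) * (2 + s) * Real.exp (-(s / 2)) ≤ 8 := by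
    have h := Real.quadratic_le_exp_of_nonneg (x := s / 2) (by positivity)
    rw [Real.exp_neg, ← div_eq_mul_inv, div_le_iff₀ (Real.exp_pos _)]
    nlinarith
  have hlin : expApprox k s - expApprox k t ≤ (t - s) * Real.exp (-(s / 2)) := by
    have h := abs_pow_sub_pow_le (1 - s / (k : ℝ)) (1 - t / k) k
    rw [abs_of_nonneg (sub_nonneg.2 hVU : (0 : ℝ) ≤ (1 - s / (k : ℝ)) ^ k - (1 - t / k) ^ k),
      abs_of_nonneg (sub_nonneg.2 hvu), abs_of_nonneg hu.1, abs_of_nonneg hv.1,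
      max_eq_left hvu] at h
    have hpow : (1 - s / (k : ℝ)) ^ (k - 1) ≤ Real.exp (-(s / 2)) := by
      calc (1 - s / (k : ℝ)) ^ (k - 1) ≤ Real.exp (-(s / k)) ^ (k - 1) :=
            pow_le_pow_left₀ hu.1 (Real.one_sub_le_exp_neg _) _
        _ = Real.exp (-(s * ((k - 1) / k))) := by
            rw [← Real.exp_nat_mul, Nat.cast_sub (by omega)]
            congr 1
            push_cast
            ring
        _ ≤ Real.exp (-(s / 2)) := by
            have : (1 : ℝ) / 2 ≤ (k - 1) / k := by
              rw [div_le_div_iff₀ two_pos hkpos]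
              linarith
            apply Real.exp_le_exp.2
            nlinarith
    have hfac : (1 - s / (k : ℝ) - (1 - t / k)) * k = t - s := by
      field_simp
      ring
    rw [hfac] at h
    exact h.trans (mul_le_mul_of_nonneg_left hpow (sub_pos.2 hst).le)
  rcases le_total (t - s) 1 with h1 | h1
  · have ht : (1 + s) * (1 + t) ≤ (1 + s) * (2 + s) := by gcongr (1 + s) * ?_ ; linarith
    calc (1 + s) * (1 + t) * (expApprox k s - expApprox k t)
        ≤ (1 + s) * (2 + s) * ((t - s) * Real.exp (-(s / 2))) :=
          mul_le_mul ht hlin (sub_nonneg.2 hVU) (by positivity)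
      _ = (1 + s) * (2 + s) * Real.exp (-(s / 2)) * (t - s) := by ring
      _ ≤ 8 * (t - s) := by gcongr
  · have hsub : expApprox k s - expApprox k t ≤ Real.exp (-(s / 2)) := by
      have h2 : expApprox k s ≤ Real.exp (-s) := Real.one_sub_div_pow_le_exp_neg (hst.le.trans htk)
      have h3 : Real.exp (-s) ≤ Real.exp (-(s / 2)) := Real.exp_le_exp.2 (by linarith)
      have := expApprox_nonneg hk0 (hs.trans hst.le) htk
      linarith
    have ht : (1 + s) * (1 + t) ≤ (t - s) * ((1 + s) * (2 + s)) := by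
      have : 1 + t ≤ (t - s) * (2 + s) := by nlinarith
      nlinarith
    calc (1 + s) * (1 + t) * (expApprox k s - expApprox k t)
        ≤ (t - s) * ((1 + s) * (2 + s)) * Real.exp (-(s / 2)) :=
          mul_le_mul ht hsub (sub_nonneg.2 hVU) (by nlinarith)
      _ = (1 + s) * (2 + s) * Real.exp (-(s / 2)) * (t - s) := by ring
      _ ≤ 8 * (t - s) := by gcongr

theorem abs_expApprox_slope_le {k : ℕ} {s t : ℝ} (hk : 2 ≤ k) (hs : 0 ≤ s) (hsk : s ≤ k)
    (ht : 0 ≤ t) (htk : t ≤ k) :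
    |(expApprox k s - expApprox k t) / (s - t)| ≤ 8 / ((1 + s) * (1 + t)) := by
  rcases lt_trichotomy s t with h | rfl | h
  · rw [abs_div, abs_sub_comm s t, abs_of_pos (sub_pos.2 h), div_le_div_iff₀ (sub_pos.2 h)
      (by positivity)]
    linarith [expApprox_sub_le hk hs h htk]
  · simp only [sub_self, div_zero, abs_zero]
    positivity
  · rw [abs_div, abs_of_pos (sub_pos.2 h), div_le_div_iff₀ (sub_pos.2 h) (by positivity),
      abs_sub_comm]
    linarith [expApprox_sub_le hk ht h hsk]

theorem abs_prelimitKernel_le {A N : ℝ} {k : ℕ} {s t : ℝ} (hA : 1 ≤ A) (hN : 0 < N) (hk : 2 ≤ k)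
    (hs : 0 ≤ s) (hsk : s ≤ k) (hsN : s ≤ 2 * N) (ht : 0 ≤ t) (htk : t ≤ k) (htN : t ≤ 2 * N) :
    |prelimitKernel A N k s t| ≤ 128 * A / ((1 + s) * (1 + t)) := by
  have hk0 : 0 < k := by omega
  have hD := abs_expApprox_slope_le hk hs hsk ht htk
  have hDA : |(expApprox k s ^ A - expApprox k t ^ A) / (s - t)| ≤
      A * (8 / ((1 + s) * (1 + t))) := by
    refine le_trans ?_ (mul_le_mul_of_nonneg_left hD (by linarith))
    rw [abs_div, abs_div, ← mul_div_assoc]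
    gcongr
    exact abs_rpow_sub_rpow_le hA (expApprox_nonneg hk0 hs hsk) (expApprox_le_one hk0 hs hsk)
      (expApprox_nonneg hk0 ht htk) (expApprox_le_one hk0 ht htk)
  have hst : s * t / N ≤ s + t := by
    rw [div_le_iff₀ hN]
    nlinarith
  have hst0 : 0 ≤ s * t / N := by positivity
  have hW : |2 * (s + t - s * t / N)| ≤ 2 * ((1 + s) * (1 + t)) := by
    rw [abs_of_nonneg (by linarith)]
    nlinarith [mul_nonneg hs ht]
  rw [prelimitKernel, abs_mul, abs_mul]
  calc _ ≤ 8 / ((1 + s) * (1 + t)) * (A * (8 / ((1 + s) * (1 + t)))) *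
        (2 * ((1 + s) * (1 + t))) := by gcongr
    _ = 128 * A / ((1 + s) * (1 + t)) := by
        field_simp
        ring

theorem slope_mul_weight_eq_prelimitKernel {A b l x y : ℝ} {k : ℕ} (hb : 0 < b) (hk : 0 < k)
    (hl : l ^ 2 = 2 / (b * k)) (hx : x ^ 2 < 1) (hy : y ^ 2 < 1) :
    l * √(1 - x ^ 2) * (l * √(1 - y ^ 2) *
      (((expApprox k (b * k * (1 - x)) - expApprox k (b * k * (1 - y))) / (x - y)) *
        ((expApprox k (b * k * (1 - x)) ^ A - expApprox k (b * k * (1 - y)) ^ A) / (x - y)) *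
        ((1 - x * y) / (√(1 - x ^ 2) * √(1 - y ^ 2))))) =
      prelimitKernel A (b * k) k (b * k * (1 - x)) (b * k * (1 - y)) := by
  have hN : (0 : ℝ) < b * k := by positivity
  set N := b * (k : ℝ)
  have h1 : 0 < √(1 - x ^ 2) := Real.sqrt_pos.2 (by linarith)
  have h2 : 0 < √(1 - y ^ 2) := Real.sqrt_pos.2 (by linarith)
  rw [prelimitKernel]
  generalize expApprox k (N * (1 - x)) = u
  generalize expApprox k (N * (1 - y)) = v
  rcases eq_or_ne x y with rfl | hxy
  · simp
  have hd : N * (1 - x) - N * (1 - y) = -(N * (x - y)) := by ring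
  have hxy' : x - y ≠ 0 := sub_ne_zero.2 hxy
  rw [hd]
  calc _ = l ^ 2 * ((u - v) / (x - y) * ((u ^ A - v ^ A) / (x - y)) * (1 - x * y)) := by
        field_simp
    _ = _ := by
        rw [hl]
        field_simp
        ring

theorem sq_div_four_le_mul_one_sub_cos {b l a : ℝ} {k : ℕ} (hb : 0 < b) (hk : 0 < k)
    (hl : l ^ 2 = 2 / (b * k)) (hla : |l * a| ≤ Real.pi) :
    a ^ 2 / 4 ≤ b * k * (1 - Real.cos (l * a)) := by
  have hN : (0 : ℝ) < b * k := by positivity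
  have h := Real.cos_le_one_sub_mul_cos_sq hla
  rw [mul_pow, hl] at h
  have hpi : Real.pi ^ 2 ≤ 16 := by
    nlinarith [Real.pi_le_four, Real.pi_pos]
  calc a ^ 2 / 4 ≤ a ^ 2 * 4 / Real.pi ^ 2 := by
        rw [div_le_div_iff₀ (by norm_num) (by positivity)]
        nlinarith [sq_nonneg a]
    _ = b * k * (2 / Real.pi ^ 2 * (2 / (b * k) * a ^ 2)) := by
        field_simp
        ring
    _ ≤ _ := by
        gcongr
        linarith

theorem tendsto_mul_one_sub_cos {b : ℝ} (hb : 0 < b) (a : ℝ) :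
    Tendsto (fun k : ℕ => b * k * (1 - Real.cos (√(2 / (b * k)) * a))) atTop (𝓝 (a ^ 2)) := by
  have hlim : Tendsto (fun k : ℕ => √(2 / (b * k)) * a / 2) atTop (𝓝 0) := by
    have h1 : Tendsto (fun k : ℕ => b * (k : ℝ)) atTop atTop :=
      tendsto_natCast_atTop_atTop.const_mul_atTop hb
    have h2 := ((Real.continuous_sqrt.tendsto 0).comp (h1.const_div_atTop 2)).mul_const (a / 2)
    simpa [mul_div_assoc] using h2
  have h : Tendsto (fun k : ℕ => a ^ 2 * Real.sinc (√(2 / (b * k)) * a / 2) ^ 2) atTop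
      (𝓝 (a ^ 2)) := by
    have h3 := (((Real.continuous_sinc.tendsto 0).comp hlim).pow 2).const_mul (a ^ 2)
    simpa using h3
  refine h.congr' ?_
  filter_upwards [eventually_gt_atTop 0] with k hk
  have hk' : (0 : ℝ) < k := by exact_mod_cast hk
  have hl : √(2 / (b * k)) ^ 2 = 2 / (b * k) := Real.sq_sqrt (by positivity)
  generalize √(2 / (b * (k : ℝ))) = l at hl
  have hcos : 1 - Real.cos (l * a) = 2 * Real.sin (l * a / 2) ^ 2 := by
    rw [Real.sin_sq_eq_half_sub]
    ring_nf
  have hsin : Real.sin (l * a / 2) = l * a / 2 * Real.sinc (l * a / 2) := by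
    rcases eq_or_ne (l * a / 2) 0 with h0 | h0
    · simp [h0]
    · rw [Real.sinc_of_ne_zero h0, mul_div_cancel₀ _ h0]
  rw [hcos, hsin, mul_pow, div_pow, mul_pow, hl]
  field_simp

theorem tendsto_expApprox {s : ℕ → ℝ} {x : ℝ} (hs : Tendsto s atTop (𝓝 x)) :
    Tendsto (fun k => expApprox k (s k)) atTop (𝓝 (Real.exp (-x))) := by
  have h : Tendsto (fun k : ℕ => (k : ℝ) * (-(s k / k))) atTop (𝓝 (-x)) := by
    refine hs.neg.congr' ?_
    filter_upwards [eventually_gt_atTop 0] with k hk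
    have : (k : ℝ) ≠ 0 := by positivity
    field_simp
  simpa only [expApprox, sub_eq_add_neg] using Real.tendsto_one_add_pow_exp_of_tendsto h

theorem tendsto_prelimitKernel {A : ℝ} {N s t : ℕ → ℝ} {x y : ℝ} (hA : 0 < A)
    (hN : Tendsto N atTop atTop) (hs : Tendsto s atTop (𝓝 x)) (ht : Tendsto t atTop (𝓝 y))
    (hxy : x ≠ y) :
    Tendsto (fun k => prelimitKernel A (N k) k (s k) (t k)) atTop
      (𝓝 ((Real.exp (-x) - Real.exp (-y)) / (x - y) *
        ((Real.exp (-(A * x)) - Real.exp (-(A * y))) / (x - y)) * (2 * (x + y)))) := by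
  have hr : ∀ z : ℝ, Real.exp (-(A * z)) = Real.exp (-z) ^ A := fun z => by
    rw [← Real.exp_mul]
    ring_nf
  have hd := sub_ne_zero.2 hxy
  have hS := tendsto_expApprox hs
  have hT := tendsto_expApprox ht
  have hw : Tendsto (fun k => s k * t k / N k) atTop (𝓝 0) := (hs.mul ht).div_atTop hN
  rw [hr, hr]
  refine (((hS.sub hT).div (hs.sub ht) hd).mul
    (((hS.rpow_const (Or.inr hA.le)).sub (hT.rpow_const (Or.inr hA.le))).div (hs.sub ht) hd)).mul
    ?_
  simpa using ((hs.add ht).sub hw).const_mul 2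

/-- The ratio of the slope of `PhiC c` to its maximum `aplus c` on `[-1, 1]`. -/
def slopeRatio (c : ℝ) : ℝ := 2 * √c / aplus c

theorem slopeRatio_pos {c : ℝ} (hc : 0 < c) : 0 < slopeRatio c := by
  unfold slopeRatio aplus
  positivity

theorem slopeRatio_le_half (c : ℝ) : slopeRatio c ≤ 1 / 2 := by
  have : 0 < aplus c := by unfold aplus; positivity
  rw [slopeRatio, div_le_div_iff₀ this two_pos, aplus]
  nlinarith [sq_nonneg (1 - √c)]

theorem PhiC_div_aplus {c : ℝ} (hc : 0 ≤ c) (x : ℝ) :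
    PhiC c x / aplus c = 1 - slopeRatio c * (1 - x) := by
  have : aplus c ≠ 0 := by unfold aplus; positivity
  rw [slopeRatio]
  field_simp
  rw [PhiC, aplus]
  linear_combination -Real.sq_sqrt hc

theorem PhiC_div_aplus_rpow_natCast {c : ℝ} {k : ℕ} (hc : 0 ≤ c) (hk : 0 < k) (x : ℝ) :
    (PhiC c x / aplus c) ^ (k : ℝ) = expApprox k (slopeRatio c * k * (1 - x)) := by
  have hk' : (k : ℝ) ≠ 0 := by positivity
  rw [PhiC_div_aplus hc, Real.rpow_natCast, expApprox]
  congr 2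
  field_simp

theorem PhiC_div_aplus_rpow_mul_natCast {c : ℝ} {k : ℕ} (A : ℝ) (hc : 0 < c) (hk : 0 < k) {x : ℝ}
    (hx : -1 ≤ x) :
    (PhiC c x / aplus c) ^ (A * (k : ℝ)) = expApprox k (slopeRatio c * k * (1 - x)) ^ A := by
  have h0 : 0 ≤ PhiC c x / aplus c := by
    rw [PhiC_div_aplus hc.le]
    nlinarith [slopeRatio_pos hc, slopeRatio_le_half c]
  rw [← PhiC_div_aplus_rpow_natCast hc.le hk, ← Real.rpow_mul h0, mul_comm]

/-- The prelimit kernel after the substitution `x = cos (l a)`, `y = cos (l b)` with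
`l = √(2 / (β k))`, extended by zero. -/
def cosKernel (A β : ℝ) (k : ℕ) (a b : ℝ) : ℝ :=
  if √(2 / (β * k)) * a < Real.pi ∧ √(2 / (β * k)) * b < Real.pi then
    prelimitKernel A (β * k) k (β * k * (1 - Real.cos (√(2 / (β * k)) * a)))
      (β * k * (1 - Real.cos (√(2 / (β * k)) * b)))
  else 0

theorem measurable_cosKernel (A β : ℝ) (k : ℕ) :
    Measurable (Function.uncurry (cosKernel A β k)) := by
  have h1 : Measurable fun p : ℝ × ℝ => √(2 / (β * k)) * p.1 := by fun_prop
  have h2 : Measurable fun p : ℝ × ℝ => √(2 / (β * k)) * p.2 := by fun_prop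
  unfold cosKernel prelimitKernel expApprox Function.uncurry
  exact Measurable.ite ((measurableSet_lt h1 measurable_const).inter
    (measurableSet_lt h2 measurable_const)) (by fun_prop) measurable_const

theorem abs_cosKernel_le {A β : ℝ} {k : ℕ} {a b : ℝ} (hA : 1 ≤ A) (hβ : 0 < β) (hβ' : β ≤ 1 / 2)
    (hk : 2 ≤ k) (ha : 0 < a) (hb : 0 < b) :
    |cosKernel A β k a b| ≤ 2048 * A * (1 + a ^ 2)⁻¹ * (1 + b ^ 2)⁻¹ := by
  have hk0 : 0 < k := by omega
  have hk' : (0 : ℝ) < k := by exact_mod_cast hk0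
  have hN : 0 < β * k := by positivity
  have hl0 : 0 ≤ √(2 / (β * k)) := Real.sqrt_nonneg _
  have hl : √(2 / (β * k)) ^ 2 = 2 / (β * k) := Real.sq_sqrt (by positivity)
  unfold cosKernel
  generalize √(2 / (β * (k : ℝ))) = l at hl hl0
  split_ifs with h
  · have hs0 : ∀ z, 0 ≤ β * k * (1 - Real.cos z) := fun z =>
      mul_nonneg hN.le (sub_nonneg.2 (Real.cos_le_one z))
    have hs2 : ∀ z, β * k * (1 - Real.cos z) ≤ 2 * (β * k) := fun z => by
      nlinarith [Real.neg_one_le_cos z]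
    have h2k : 2 * (β * k) ≤ k := by nlinarith
    have hsa := sq_div_four_le_mul_one_sub_cos hβ hk0 hl (a := a)
      (by rw [abs_of_nonneg (by positivity)]; exact h.1.le)
    have hsb := sq_div_four_le_mul_one_sub_cos hβ hk0 hl (a := b)
      (by rw [abs_of_nonneg (by positivity)]; exact h.2.le)
    refine (abs_prelimitKernel_le hA hN hk (hs0 _) ((hs2 _).trans h2k) (hs2 _) (hs0 _)
      ((hs2 _).trans h2k) (hs2 _)).trans ?_
    calc _ ≤ 128 * A / ((1 + a ^ 2) / 4 * ((1 + b ^ 2) / 4)) := by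
          gcongr <;> linarith [hs0 (l * a), hs0 (l * b), sq_nonneg a, sq_nonneg b]
      _ = _ := by
          field_simp
          ring
  · rw [abs_zero]
    positivity

theorem tendsto_cosKernel {A β : ℝ} (hA : 0 < A) (hβ : 0 < β) {a b : ℝ} (ha : 0 < a)
    (hb : 0 < b) :
    Tendsto (fun k => cosKernel A β k a b) atTop
      (𝓝 (1 / 2 * (2 * a * (2 * b * limitKernel A (a ^ 2) (b ^ 2))))) := by
  rcases eq_or_ne a b with rfl | hab
  · simp [cosKernel, prelimitKernel, limitKernel]
  have hNlim : Tendsto (fun k : ℕ => β * (k : ℝ)) atTop atTop :=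
    tendsto_natCast_atTop_atTop.const_mul_atTop hβ
  have hlim : ∀ z, ∀ᶠ k : ℕ in atTop, √(2 / (β * k)) * z < Real.pi := fun z => by
    have h2 := ((Real.continuous_sqrt.tendsto 0).comp (hNlim.const_div_atTop 2)).mul_const z
    rw [Real.sqrt_zero, zero_mul] at h2
    exact h2.eventually_lt_const Real.pi_pos
  have hab2 : a ^ 2 ≠ b ^ 2 := fun h => hab ((sq_eq_sq₀ ha.le hb.le).1 h)
  have h := tendsto_prelimitKernel hA hNlim (tendsto_mul_one_sub_cos hβ a)
    (tendsto_mul_one_sub_cos hβ b) hab2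
  have hval : 1 / 2 * (2 * a * (2 * b * limitKernel A (a ^ 2) (b ^ 2))) =
      (Real.exp (-a ^ 2) - Real.exp (-b ^ 2)) / (a ^ 2 - b ^ 2) *
        ((Real.exp (-(A * a ^ 2)) - Real.exp (-(A * b ^ 2))) / (a ^ 2 - b ^ 2)) *
        (2 * (a ^ 2 + b ^ 2)) := by
    have hsqrt : √(a ^ 2 * b ^ 2) = a * b := by
      rw [← mul_pow, Real.sqrt_sq (by positivity)]
    have hd := sub_ne_zero.2 hab2
    rw [limitKernel, hsqrt]
    field_simp
  rw [hval]
  refine h.congr' ?_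
  filter_upwards [hlim a, hlim b] with k hka hkb
  rw [cosKernel, if_pos ⟨hka, hkb⟩]

theorem setIntegral_Ioo_eq_integral_Ioi_ite {l : ℝ} (hl : 0 < l) (F : ℝ → ℝ) :
    ∫ a in Set.Ioo 0 (Real.pi / l), F a =
      ∫ a in Set.Ioi (0 : ℝ), if l * a < Real.pi then F a else 0 := by
  rw [← Set.Ioi_inter_Iio, ← setIntegral_indicator measurableSet_Iio]
  congr 1 with a
  simp only [Set.indicator, Set.mem_Iio, lt_div_iff₀' hl]

theorem GamC_eq_integral_cosKernel {c A : ℝ} {k : ℕ} (hc : 0 < c) (hk : 0 < k) :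
    GamC c (fun x => (x / aplus c) ^ (k : ℝ)) (fun x => (x / aplus c) ^ (A * (k : ℝ))) =
      1 / Real.pi ^ 2 *
        ∫ a in Set.Ioi (0 : ℝ), ∫ b in Set.Ioi (0 : ℝ), cosKernel A (slopeRatio c) k a b := by
  have hβ := slopeRatio_pos hc
  have hk' : (0 : ℝ) < k := by exact_mod_cast hk
  have hl : √(2 / (slopeRatio c * k)) ^ 2 = 2 / (slopeRatio c * k) := Real.sq_sqrt (by positivity)
  have hl0 : 0 < √(2 / (slopeRatio c * k)) := Real.sqrt_pos.2 (by positivity)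
  rw [GamC, Gam]
  unfold cosKernel
  generalize √(2 / (slopeRatio c * (k : ℝ))) = l at hl hl0
  congr 1
  rw [integral_eq_integral_cos_mul hl0, setIntegral_Ioo_eq_integral_Ioi_ite hl0]
  refine setIntegral_congr_fun measurableSet_Ioi fun a ha => ?_
  split_ifs with hla
  · rw [integral_eq_integral_cos_mul hl0, setIntegral_Ioo_eq_integral_Ioi_ite hl0,
      ← integral_const_mul]
    refine setIntegral_congr_fun measurableSet_Ioi fun b hb => ?_
    by_cases hlb : l * b < Real.pi
    · have hsa := Real.sin_pos_of_mem_Ioo ⟨mul_pos hl0 ha, hla⟩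
      have hsb := Real.sin_pos_of_mem_Ioo ⟨mul_pos hl0 hb, hlb⟩
      have h := slope_mul_weight_eq_prelimitKernel (A := A) hβ hk hl
        (x := Real.cos (l * a)) (y := Real.cos (l * b))
        (by nlinarith [Real.sin_sq_add_cos_sq (l * a)])
        (by nlinarith [Real.sin_sq_add_cos_sq (l * b)])
      rw [if_pos hlb, if_pos ⟨hla, hlb⟩, ← h]
      simp only [Function.comp_apply, PhiC_div_aplus_rpow_natCast hc.le hk,
        PhiC_div_aplus_rpow_mul_natCast A hc hk (Real.neg_one_le_cos _)]
      rw [Real.sin_eq_sqrt_one_sub_cos_sq (mul_pos hl0 ha).le hla.le,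
        Real.sin_eq_sqrt_one_sub_cos_sq (mul_pos hl0 hb).le hlb.le]
    · simp [hlb]
  · simp [hla]

/-- Lemma 6.4 of the paper: for fixed `c, A ∈ [1, ∞)` and `h_r(x) = (x/a₊)^r` (real powers),
`Γ_c(h_k, h_{Ak})` converges, as `k → ∞` over positive integers, to
`(1/(2π²)) ∫₀^∞ ∫₀^∞ ((e^{−s} − e^{−t})/(s − t)) ((e^{−As} − e^{−At})/(s − t)) (s + t)/√(st) ds dt`. -/
theorem GamC_limit_integral (c : ℝ) (hc : 1 ≤ c) (A : ℝ) (hA : 1 ≤ A) :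
    Tendsto
      (fun k : ℕ => GamC c (fun x => (x / aplus c) ^ (k : ℝ))
        (fun x => (x / aplus c) ^ (A * (k : ℝ))))
      atTop
      (𝓝 ((1 / (2 * Real.pi ^ 2)) *
        ∫ s in Set.Ioi (0 : ℝ), ∫ t in Set.Ioi (0 : ℝ), limitKernel A s t)) := by
  have hc0 : 0 < c := by linarith
  have hβ := slopeRatio_pos hc0
  have hR : 1 / (2 * Real.pi ^ 2) *
      ∫ s in Set.Ioi (0 : ℝ), ∫ t in Set.Ioi (0 : ℝ), limitKernel A s t =
      1 / Real.pi ^ 2 * ∫ a in Set.Ioi (0 : ℝ), ∫ b in Set.Ioi (0 : ℝ),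
        1 / 2 * (2 * a * (2 * b * limitKernel A (a ^ 2) (b ^ 2))) := by
    rw [integral_Ioi_eq_integral_sq]
    simp_rw [integral_Ioi_eq_integral_sq (limitKernel A _), integral_const_mul]
    ring
  rw [hR]
  have hint : IntegrableOn (fun a : ℝ => (1 + a ^ 2)⁻¹) (Set.Ioi 0) :=
    integrable_inv_one_add_sq.integrableOn
  have hpos : ∀ᵐ a : ℝ ∂volume.restrict (Set.Ioi 0), 0 < a := ae_restrict_mem measurableSet_Ioi
  have h := tendsto_integral_integral_of_dominated_convergence
    (measurable_cosKernel A (slopeRatio c)) (hint.const_mul (2048 * A)) hint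
    (eventually_atTop.2 ⟨2, fun k hk => hpos.mono fun a ha => hpos.mono fun b hb =>
      abs_cosKernel_le hA hβ (slopeRatio_le_half c) hk ha hb⟩)
    (hpos.mono fun a ha => hpos.mono fun b hb => tendsto_cosKernel (by linarith) hβ ha hb)
  refine (h.const_mul (1 / Real.pi ^ 2)).congr' ?_
  filter_upwards [eventually_gt_atTop 0] with k hk
  exact (GamC_eq_integral_cosKernel hc0 hk).symm
end
end

section
/- Fix a positive integer A and for each positive integer r let p_r(x) = x^r. Then, with the limit taken over positive integers k, lim_{k→∞} Γ(p_{2k}, p_{2Ak}) = (1/π²) ∫₀^∞ ∫₀^∞ ((e^{−s} − e^{−t})/(s − t)) · ((e^{−As} − e^{−At})/(s − t)) · (s + t)/√(st) ds dt. -/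
open MeasureTheory ProbabilityTheory Filter Topology

noncomputable section

lemma le_one_add_mul_one_sub_exp_neg {d : ℝ} (hd : 0 ≤ d) :
    d ≤ (1 + d) * (1 - Real.exp (-d)) := by
  have h1 := Real.add_one_le_exp d
  have h2 : Real.exp d * Real.exp (-d) = 1 := by rw [← Real.exp_add]; simp
  nlinarith [Real.exp_pos (-d)]

lemma one_add_mul_exp_neg_div_four_le (d : ℝ) :
    (1 + d) * Real.exp (-(d / 4)) ≤ 4 := by
  have h1 := Real.add_one_le_exp (d / 4)
  have h2 : Real.exp (d / 4) * Real.exp (-(d / 4)) = 1 := by rw [← Real.exp_add]; simp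
  nlinarith [Real.exp_pos (-(d / 4))]

lemma sq_mul_exp_neg_half_le {d : ℝ} (hd : 0 ≤ d) :
    d ^ 2 * Real.exp (-(d / 2)) ≤ 16 * (1 - Real.exp (-d)) ^ 2 := by
  have h1 := le_one_add_mul_one_sub_exp_neg hd
  have h2 := one_add_mul_exp_neg_div_four_le d
  have h3 : Real.exp (-(d / 2)) = Real.exp (-(d / 4)) ^ 2 := by
    rw [← Real.exp_nat_mul]; congr 1; push_cast; ring
  have h4 : 0 ≤ 1 - Real.exp (-d) := by
    have : Real.exp (-d) ≤ 1 := Real.exp_le_one_iff.2 (by linarith)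
    linarith
  have h5 : d * Real.exp (-(d / 4)) ≤ 4 * (1 - Real.exp (-d)) := by
    calc d * Real.exp (-(d / 4))
        ≤ ((1 + d) * (1 - Real.exp (-d))) * Real.exp (-(d / 4)) := by gcongr
      _ = ((1 + d) * Real.exp (-(d / 4))) * (1 - Real.exp (-d)) := by ring
      _ ≤ 4 * (1 - Real.exp (-d)) := by gcongr
  calc d ^ 2 * Real.exp (-(d / 2)) = (d * Real.exp (-(d / 4))) ^ 2 := by rw [h3]; ring
    _ ≤ (4 * (1 - Real.exp (-d))) ^ 2 := by gcongr
    _ = _ := by ring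

lemma one_sub_exp_neg_pos {a : ℝ} (ha : 0 < a) : 0 < 1 - Real.exp (-a) := by
  have : Real.exp (-a) < 1 := Real.exp_lt_one_iff.2 (by linarith)
  linarith

/-- The function `(1 - exp (-x)) / x` is decreasing. -/
lemma mul_one_sub_exp_neg_le {a b : ℝ} (hb : 0 < b) (hab : b ≤ a) :
    b * (1 - Real.exp (-a)) ≤ a * (1 - Real.exp (-b)) := by
  have h1 : Real.exp (-a) = Real.exp (-b) * Real.exp (-(a - b)) := by
    rw [← Real.exp_add]; congr 1; ring
  have h2 := Real.add_one_le_exp (-(a - b))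
  have h3 := Real.add_one_le_exp b
  have h4 : Real.exp b * Real.exp (-b) = 1 := by rw [← Real.exp_add]; simp
  have h5 : b * Real.exp (-b) ≤ 1 - Real.exp (-b) := by nlinarith [Real.exp_pos (-b)]
  have h6 := Real.exp_pos (-b)
  rw [h1]
  nlinarith [mul_le_mul_of_nonneg_left h5 (sub_nonneg.2 hab),
    mul_le_mul_of_nonneg_left h2 (mul_pos hb h6).le]

lemma add_mul_sqrt_mul_le {a b p q : ℝ} (hb : 0 < b) (hab : b ≤ a) (hq : 0 < q) (hqp : q ≤ p)
    (h : b * p ≤ a * q) : (p + q) * √(a * b) ≤ (a + b) * √(p * q) := by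
  have ha : 0 < a := hb.trans_le hab
  have hp : 0 < p := hq.trans_le hqp
  refine le_of_sq_le_sq ?_ (by positivity)
  rw [mul_pow, mul_pow, Real.sq_sqrt (by positivity), Real.sq_sqrt (by positivity)]
  have h1 : b * q ≤ a * p := by gcongr
  nlinarith [mul_nonneg (sub_nonneg.2 h) (sub_nonneg.2 h1)]

/-- The weight obtained from `(1 - x * y) / (x - y) ^ 2 / √(1 - x ^ 2) / √(1 - y ^ 2)` by
symmetrising over the signs of `x`, `y` and substituting `x = exp (-h s / 2)`,
`y = exp (-h t / 2)`. -/
def expWeight (h s t : ℝ) : ℝ :=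
  h ^ 2 * (Real.exp (-(h * s)) + Real.exp (-(h * t))
      - 2 * Real.exp (-(h * s)) * Real.exp (-(h * t))) * Real.exp (-((h * s + h * t) / 2)) /
    ((Real.exp (-(h * s)) - Real.exp (-(h * t))) ^ 2 *
      (√(1 - Real.exp (-(h * s))) * √(1 - Real.exp (-(h * t)))))

lemma expWeight_comm (h s t : ℝ) : expWeight h s t = expWeight h t s := by
  unfold expWeight
  congr 1
  · rw [add_comm (h * s)]; ring
  · ring

lemma expWeight_core {a b : ℝ} (hb : 0 < b) (hab : b < a) :
    (a - b) ^ 2 * (Real.exp (-a) + Real.exp (-b) - 2 * Real.exp (-a) * Real.exp (-b)) *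
        Real.exp (-((a + b) / 2)) * √(a * b) ≤
      16 * (Real.exp (-a) - Real.exp (-b)) ^ 2 *
        (√(1 - Real.exp (-a)) * √(1 - Real.exp (-b))) * (a + b) := by
  have ha : 0 < a := hb.trans hab
  have hp := one_sub_exp_neg_pos ha
  have hq := one_sub_exp_neg_pos hb
  have huv : Real.exp (-a) ≤ Real.exp (-b) := Real.exp_le_exp.2 (by linarith)
  have h1 := add_mul_sqrt_mul_le hb hab.le hq (by linarith) (mul_one_sub_exp_neg_le hb hab.le)
  have h2 := sq_mul_exp_neg_half_le (sub_nonneg.2 hab.le)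
  have h3 : Real.exp (-a) = Real.exp (-b) * Real.exp (-(a - b)) := by
    rw [← Real.exp_add]; congr 1; ring
  have h4 : Real.exp (-((a + b) / 2)) = Real.exp (-b) * Real.exp (-((a - b) / 2)) := by
    rw [← Real.exp_add]; congr 1; ring
  have hv := Real.exp_pos (-b)
  have hw := Real.exp_pos (-((a - b) / 2))
  rw [← Real.sqrt_mul hp.le]
  have h5 : Real.exp (-a) + Real.exp (-b) - 2 * Real.exp (-a) * Real.exp (-b) ≤
      Real.exp (-b) * ((1 - Real.exp (-a)) + (1 - Real.exp (-b))) := by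
    nlinarith
  calc _ ≤ (a - b) ^ 2 * (Real.exp (-b) * ((1 - Real.exp (-a)) + (1 - Real.exp (-b)))) *
        Real.exp (-((a + b) / 2)) * √(a * b) := by gcongr
    _ = Real.exp (-b) ^ 2 * ((a - b) ^ 2 * Real.exp (-((a - b) / 2))) *
        (((1 - Real.exp (-a)) + (1 - Real.exp (-b))) * √(a * b)) := by rw [h4]; ring
    _ ≤ Real.exp (-b) ^ 2 * (16 * (1 - Real.exp (-(a - b))) ^ 2) *
        ((a + b) * √((1 - Real.exp (-a)) * (1 - Real.exp (-b)))) := by gcongr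
    _ = _ := by rw [show Real.exp (-a) - Real.exp (-b) =
          - (Real.exp (-b) * (1 - Real.exp (-(a - b)))) by rw [h3]; ring]; ring

lemma expWeight_nonneg {h s t : ℝ} (hh : 0 < h) (hs : 0 < s) (ht : 0 < t) :
    0 ≤ expWeight h s t := by
  have hp := one_sub_exp_neg_pos (mul_pos hh hs)
  have hq := one_sub_exp_neg_pos (mul_pos hh ht)
  have : 0 ≤ Real.exp (-(h * s)) + Real.exp (-(h * t))
      - 2 * Real.exp (-(h * s)) * Real.exp (-(h * t)) := by
    nlinarith [Real.exp_pos (-(h * s)), Real.exp_pos (-(h * t))]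
  unfold expWeight
  positivity

lemma expWeight_le_of_lt {h s t : ℝ} (hh : 0 < h) (ht : 0 < t) (hst : t < s) :
    expWeight h s t ≤ 16 * ((s + t) / √(s * t) / (s - t) ^ 2) := by
  have hs : 0 < s := ht.trans hst
  have hp := one_sub_exp_neg_pos (mul_pos hh hs)
  have hq := one_sub_exp_neg_pos (mul_pos hh ht)
  have key := expWeight_core (mul_pos hh ht) (mul_lt_mul_of_pos_left hst hh)
  have hne : Real.exp (-(h * s)) - Real.exp (-(h * t)) ≠ 0 := by
    rw [sub_ne_zero, Ne, Real.exp_eq_exp, neg_inj]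
    exact (mul_lt_mul_of_pos_left hst hh).ne'
  have hsq : √(h * s * (h * t)) = h * √(s * t) := by
    rw [show h * s * (h * t) = h ^ 2 * (s * t) by ring, Real.sqrt_mul (by positivity),
      Real.sqrt_sq hh.le]
  rw [hsq] at key
  have hd : 0 < s - t := sub_pos.2 hst
  have hr : 0 < √(s * t) := Real.sqrt_pos.2 (by positivity)
  unfold expWeight
  rw [div_div, ← mul_div_assoc, div_le_div_iff₀ (by positivity) (by positivity)]
  refine le_of_mul_le_mul_left ?_ hh
  calc _ = _ := by ring
    _ ≤ _ := key
    _ = _ := by ring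

lemma expWeight_le {h s t : ℝ} (hh : 0 < h) (hs : 0 < s) (ht : 0 < t) (hst : s ≠ t) :
    expWeight h s t ≤ 16 * ((s + t) / √(s * t) / (s - t) ^ 2) := by
  rcases lt_or_gt_of_ne hst with h1 | h1
  · rw [expWeight_comm, add_comm s, mul_comm s, ← neg_sub t s, neg_sq]
    exact expWeight_le_of_lt hh hs h1
  · exact expWeight_le_of_lt hh ht h1

lemma tendsto_one_sub_exp_neg_mul_div (s : ℝ) :
    Tendsto (fun h : ℝ => (1 - Real.exp (-(h * s))) / h) (𝓝[>] 0) (𝓝 s) := by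
  have h1 : HasDerivAt (fun h : ℝ => 1 - Real.exp (-(h * s))) s 0 := by
    have := (((hasDerivAt_id (0 : ℝ)).mul_const s).neg.exp).const_sub 1
    simpa using this
  have h2 := h1.tendsto_slope_zero_right
  refine h2.congr fun h => ?_
  simp [div_eq_inv_mul]

lemma tendsto_expWeight {s t : ℝ} (hs : 0 < s) (ht : 0 < t) (hst : s ≠ t) :
    Tendsto (fun h => expWeight h s t) (𝓝[>] 0) (𝓝 ((s + t) / √(s * t) / (s - t) ^ 2)) := by
  have hP := tendsto_one_sub_exp_neg_mul_div s
  have hQ := tendsto_one_sub_exp_neg_mul_div t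
  have hu (c : ℝ) : Tendsto (fun h : ℝ => Real.exp (-(h * c))) (𝓝[>] 0) (𝓝 1) := by
    have : ContinuousAt (fun h : ℝ => Real.exp (-(h * c))) 0 := by fun_prop
    simpa [ContinuousAt] using this.tendsto.mono_left nhdsWithin_le_nhds
  have hr : 0 < √(s * t) := Real.sqrt_pos.2 (by positivity)
  have main := ((((hu s).mul hQ).add ((hu t).mul hP)).mul (hu ((s + t) / 2))).div
    (((hQ.sub hP).pow 2).mul (hP.mul hQ).sqrt)
    (mul_ne_zero (pow_ne_zero 2 (sub_ne_zero.2 hst.symm)) hr.ne')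
  have e : (1 * t + 1 * s) * 1 / ((t - s) ^ 2 * √(s * t)) =
      (s + t) / √(s * t) / (s - t) ^ 2 := by
    rw [div_div]; congr 1 <;> ring
  rw [e] at main
  refine main.congr' ?_
  filter_upwards [self_mem_nhdsWithin] with h hh
  have hh : 0 < h := hh
  have hp := one_sub_exp_neg_pos (mul_pos hh hs)
  have hq := one_sub_exp_neg_pos (mul_pos hh ht)
  have hne : Real.exp (-(h * s)) - Real.exp (-(h * t)) ≠ 0 := by
    rw [sub_ne_zero, Ne, Real.exp_eq_exp, neg_inj]
    exact fun h0 => hst (mul_left_cancel₀ hh.ne' h0)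
  have hne' : (1 - Real.exp (-(h * t))) / h - (1 - Real.exp (-(h * s))) / h =
      (Real.exp (-(h * s)) - Real.exp (-(h * t))) / h := by ring
  have hsq : √((1 - Real.exp (-(h * s))) / h * ((1 - Real.exp (-(h * t))) / h)) =
      √(1 - Real.exp (-(h * s))) * √(1 - Real.exp (-(h * t))) / h := by
    rw [div_mul_div_comm, Real.sqrt_div (by positivity), Real.sqrt_mul_self hh.le,
      Real.sqrt_mul hp.le]
  simp only [Pi.div_apply]
  rw [hne', hsq, show -(h * ((s + t) / 2)) = -((h * s + h * t) / 2) by ring]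
  unfold expWeight
  have := Real.sqrt_pos.2 hp
  have := Real.sqrt_pos.2 hq
  field_simp
  ring

lemma limitKernel_comm (A s t : ℝ) : limitKernel A s t = limitKernel A t s := by
  unfold limitKernel
  rw [← neg_sub t s, ← neg_sub (Real.exp (-t)), ← neg_sub (Real.exp (-(A * t))), neg_div_neg_eq,
    neg_div_neg_eq, add_comm s, mul_comm s]

lemma exp_neg_diff_quotient_le {c s t : ℝ} (hc : 1 ≤ c) (hs : 0 < s) (hst : s < t) :
    (Real.exp (-(c * s)) - Real.exp (-(c * t))) / (t - s) ≤
      2 * c * Real.exp (-s) / (1 + (t - s)) := by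
  have hd : 0 < t - s := sub_pos.2 hst
  have h1 : Real.exp (-(c * t)) = Real.exp (-(c * s)) * Real.exp (-(c * (t - s))) := by
    rw [← Real.exp_add]; congr 1; ring
  have h2 : Real.exp (-(c * s)) ≤ Real.exp (-s) := Real.exp_le_exp.2 (by nlinarith)
  have h3 := Real.add_one_le_exp (-(c * (t - s)))
  have h4 := Real.exp_pos (-(c * (t - s)))
  have h5 : (1 - Real.exp (-(c * (t - s)))) * (1 + (t - s)) ≤ 2 * c * (t - s) := by nlinarith
  have h6 := (one_sub_exp_neg_pos (show 0 < c * (t - s) by positivity)).le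
  rw [div_le_div_iff₀ hd (by positivity)]
  calc _ = Real.exp (-(c * s)) * ((1 - Real.exp (-(c * (t - s)))) * (1 + (t - s))) := by
        rw [h1]; ring
    _ ≤ Real.exp (-s) * (2 * c * (t - s)) := by gcongr
    _ = _ := by ring

lemma limitKernel_nonneg {A s t : ℝ} (hA : 1 ≤ A) (hs : 0 < s) (ht : 0 < t) :
    0 ≤ limitKernel A s t := by
  wlog hst : s ≤ t generalizing s t
  · rw [limitKernel_comm]; exact this ht hs (le_of_not_ge hst)
  have h1 : Real.exp (-t) ≤ Real.exp (-s) := Real.exp_le_exp.2 (by linarith)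
  have h2 : Real.exp (-(A * t)) ≤ Real.exp (-(A * s)) := Real.exp_le_exp.2 (by nlinarith)
  unfold limitKernel
  refine mul_nonneg (mul_nonneg_of_nonpos_of_nonpos ?_ ?_) (by positivity)
  · exact div_nonpos_of_nonneg_of_nonpos (by linarith) (by linarith)
  · exact div_nonpos_of_nonneg_of_nonpos (by linarith) (by linarith)

lemma limitKernel_le_of_lt {A s t : ℝ} (hA : 1 ≤ A) (hs : 0 < s) (hst : s < t) :
    limitKernel A s t ≤ 32 * A *
      ((Real.exp (-s) * s ^ ((1 / 2 : ℝ) - 1)) * (t + 1) ^ (-(3 / 2) : ℝ)) := by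
  have ht : 0 < t := hs.trans hst
  have hd : 0 < t - s := sub_pos.2 hst
  have h1 := exp_neg_diff_quotient_le le_rfl hs hst
  have h2 := exp_neg_diff_quotient_le hA hs hst
  have h3 : s ^ ((1 / 2 : ℝ) - 1) = 1 / √s := by
    rw [show (1 / 2 : ℝ) - 1 = -(1 / 2) by norm_num, Real.rpow_neg hs.le, Real.sqrt_eq_rpow,
      one_div (s ^ _)]
  have h4 : (t + 1) ^ (-(3 / 2) : ℝ) = √(t + 1) / (t + 1) ^ 2 := by
    rw [Real.sqrt_eq_rpow, ← Real.rpow_natCast, ← Real.rpow_sub (by linarith)]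
    norm_num
  have h5 : (s + t) / √(s * t) ≤ 2 * √t / √s := by
    rw [Real.sqrt_mul hs.le, div_le_div_iff₀ (by positivity) (by positivity)]
    have e : 2 * √t * (√s * √t) = 2 * t * √s := by
      calc _ = 2 * (√t * √t) * √s := by ring
        _ = _ := by rw [Real.mul_self_sqrt ht.le]
    rw [e]
    gcongr
    linarith
  have h6 : t + 1 ≤ 2 * Real.exp (s / 2) * (1 + (t - s)) := by
    have := Real.add_one_le_exp (s / 2)
    nlinarith
  have h7 : Real.exp (-s) ^ 2 / (1 + (t - s)) ^ 2 ≤ 4 * Real.exp (-s) / (t + 1) ^ 2 := by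
    rw [div_le_div_iff₀ (by positivity) (by positivity)]
    have e : Real.exp (s / 2) ^ 2 * Real.exp (-s) = 1 := by
      rw [← Real.exp_nat_mul, ← Real.exp_add]; simp; ring
    calc _ ≤ Real.exp (-s) ^ 2 * (2 * Real.exp (s / 2) * (1 + (t - s))) ^ 2 := by gcongr
      _ = 4 * Real.exp (-s) * (1 + (t - s)) ^ 2 * (Real.exp (s / 2) ^ 2 * Real.exp (-s)) := by ring
      _ = _ := by rw [e, mul_one]
  have h8 : 0 ≤ (Real.exp (-(A * s)) - Real.exp (-(A * t))) / (t - s) := by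
    refine div_nonneg (sub_nonneg.2 (Real.exp_le_exp.2 ?_)) hd.le
    nlinarith
  rw [limitKernel_comm, limitKernel]
  calc (Real.exp (-t) - Real.exp (-s)) / (t - s) *
        ((Real.exp (-(A * t)) - Real.exp (-(A * s))) / (t - s)) * ((t + s) / √(t * s))
      = (Real.exp (-(1 * s)) - Real.exp (-(1 * t))) / (t - s) *
        ((Real.exp (-(A * s)) - Real.exp (-(A * t))) / (t - s)) * ((s + t) / √(s * t)) := by
        rw [add_comm t, mul_comm t s, one_mul, one_mul]; ring
    _ ≤ (2 * 1 * Real.exp (-s) / (1 + (t - s))) * (2 * A * Real.exp (-s) / (1 + (t - s))) *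
        (2 * √t / √s) := by gcongr
    _ = 8 * A * (Real.exp (-s) ^ 2 / (1 + (t - s)) ^ 2) * (√t / √s) := by
        rw [← div_pow]; ring
    _ ≤ 8 * A * (4 * Real.exp (-s) / (t + 1) ^ 2) * (√(t + 1) / √s) := by
        gcongr; linarith
    _ = _ := by rw [h3, h4]; ring

lemma measurable_limitKernel (A : ℝ) : Measurable fun p : ℝ × ℝ => limitKernel A p.1 p.2 := by
  unfold limitKernel; fun_prop

lemma ae_fst_ne_snd :
    ∀ᵐ p : ℝ × ℝ ∂((volume.restrict (Set.Ioi (0 : ℝ))).prod (volume.restrict (Set.Ioi (0 : ℝ)))),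
      0 < p.1 ∧ 0 < p.2 ∧ p.1 ≠ p.2 := by
  have hm : MeasurableSet {p : ℝ × ℝ | 0 < p.1 ∧ 0 < p.2 ∧ p.1 ≠ p.2} :=
    (measurableSet_lt measurable_const measurable_fst).inter
      ((measurableSet_lt measurable_const measurable_snd).inter
        (measurableSet_eq_fun measurable_fst measurable_snd).compl)
  rw [Measure.ae_prod_iff_ae_ae hm]
  filter_upwards [ae_restrict_mem measurableSet_Ioi] with s hs
  filter_upwards [ae_restrict_mem measurableSet_Ioi,
    ae_restrict_of_ae (measure_eq_zero_iff_ae_notMem.1 (measure_singleton s))] with t ht hne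
  exact ⟨hs, ht, fun h => hne h.symm⟩

lemma integrable_limitKernel {A : ℝ} (hA : 1 ≤ A) :
    Integrable (fun p : ℝ × ℝ => limitKernel A p.1 p.2)
      ((volume.restrict (Set.Ioi (0 : ℝ))).prod (volume.restrict (Set.Ioi (0 : ℝ)))) := by
  have hg : IntegrableOn (fun x : ℝ => Real.exp (-x) * x ^ ((1 / 2 : ℝ) - 1)) (Set.Ioi 0) :=
    Real.GammaIntegral_convergent (by norm_num)
  have hG : IntegrableOn (fun x : ℝ => (x + 1) ^ (-(3 / 2) : ℝ)) (Set.Ioi 0) :=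
    integrableOn_add_rpow_Ioi_of_lt (by norm_num) (by norm_num)
  have hb := ((hg.mul_prod hG).add (hG.mul_prod hg)).const_mul (32 * A)
  refine hb.mono' (measurable_limitKernel A).aestronglyMeasurable ?_
  filter_upwards [ae_fst_ne_snd] with ⟨s, t⟩ ⟨hs, ht, hne⟩
  dsimp only at hs ht hne ⊢
  rw [Real.norm_of_nonneg (limitKernel_nonneg hA hs ht)]
  simp only [Pi.add_apply]
  have p1 : 0 ≤ Real.exp (-s) * s ^ ((1 / 2 : ℝ) - 1) * (t + 1) ^ (-(3 / 2) : ℝ) := by positivity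
  have p2 : 0 ≤ (s + 1) ^ (-(3 / 2) : ℝ) * (Real.exp (-t) * t ^ ((1 / 2 : ℝ) - 1)) := by positivity
  rcases lt_or_gt_of_ne hne with h | h
  · refine (limitKernel_le_of_lt hA hs h).trans ?_
    gcongr
    linarith
  · rw [limitKernel_comm]
    refine (limitKernel_le_of_lt hA ht h).trans ?_
    gcongr
    linarith

/-- The rescaled integrand. -/
def scaledKernel (A h s t : ℝ) : ℝ :=
  (Real.exp (-s) - Real.exp (-t)) * (Real.exp (-(A * s)) - Real.exp (-(A * t))) * expWeight h s t

lemma limitKernel_eq (A s t : ℝ) : limitKernel A s t =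
    (Real.exp (-s) - Real.exp (-t)) * (Real.exp (-(A * s)) - Real.exp (-(A * t))) *
      ((s + t) / √(s * t) / (s - t) ^ 2) := by
  unfold limitKernel
  generalize s - t = d
  ring

lemma exp_diff_mul_exp_diff_nonneg {A : ℝ} (hA : 1 ≤ A) (s t : ℝ) :
    0 ≤ (Real.exp (-s) - Real.exp (-t)) * (Real.exp (-(A * s)) - Real.exp (-(A * t))) := by
  rcases le_total s t with h | h
  · refine mul_nonneg (sub_nonneg.2 (Real.exp_le_exp.2 (by linarith)))
      (sub_nonneg.2 (Real.exp_le_exp.2 (by nlinarith)))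
  · refine mul_nonneg_of_nonpos_of_nonpos (sub_nonpos.2 (Real.exp_le_exp.2 (by linarith)))
      (sub_nonpos.2 (Real.exp_le_exp.2 (by nlinarith)))

lemma measurable_scaledKernel (A h : ℝ) :
    Measurable fun p : ℝ × ℝ => scaledKernel A h p.1 p.2 := by
  unfold scaledKernel expWeight; fun_prop

lemma norm_scaledKernel_le {A h s t : ℝ} (hA : 1 ≤ A) (hh : 0 < h) (hs : 0 < s) (ht : 0 < t)
    (hst : s ≠ t) : ‖scaledKernel A h s t‖ ≤ 16 * limitKernel A s t := by
  have h1 := exp_diff_mul_exp_diff_nonneg hA s t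
  rw [scaledKernel, Real.norm_of_nonneg (mul_nonneg h1 (expWeight_nonneg hh hs ht)),
    limitKernel_eq, mul_left_comm]
  exact mul_le_mul_of_nonneg_left (expWeight_le hh hs ht hst) h1

lemma tendsto_integral_scaledKernel {A : ℝ} (hA : 1 ≤ A) :
    Tendsto (fun h : ℝ => ∫ s in Set.Ioi (0 : ℝ), ∫ t in Set.Ioi (0 : ℝ), scaledKernel A h s t)
      (𝓝[>] 0) (𝓝 (∫ s in Set.Ioi (0 : ℝ), ∫ t in Set.Ioi (0 : ℝ), limitKernel A s t)) := by
  have hint := integrable_limitKernel hA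
  have hbd {h : ℝ} (hh : 0 < h) : ∀ᵐ p : ℝ × ℝ ∂((volume.restrict (Set.Ioi (0 : ℝ))).prod
      (volume.restrict (Set.Ioi (0 : ℝ)))),
      ‖scaledKernel A h p.1 p.2‖ ≤ 16 * limitKernel A p.1 p.2 := by
    filter_upwards [ae_fst_ne_snd] with p hp
    exact norm_scaledKernel_le hA hh hp.1 hp.2.1 hp.2.2
  have main := tendsto_integral_filter_of_dominated_convergence
    (μ := (volume.restrict (Set.Ioi (0 : ℝ))).prod (volume.restrict (Set.Ioi (0 : ℝ))))
    (l := 𝓝[>] (0 : ℝ)) (F := fun h p => scaledKernel A h p.1 p.2)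
    (f := fun p => limitKernel A p.1 p.2) (fun p => 16 * limitKernel A p.1 p.2)
    (Eventually.of_forall fun h => (measurable_scaledKernel A h).aestronglyMeasurable)
    (by filter_upwards [self_mem_nhdsWithin] with h hh using hbd hh)
    (hint.const_mul 16)
    (by
      filter_upwards [ae_fst_ne_snd] with p hp
      rw [limitKernel_eq]
      exact (tendsto_expWeight hp.1 hp.2.1 hp.2.2).const_mul _)
  rw [integral_prod _ hint] at main
  refine main.congr' ?_
  filter_upwards [self_mem_nhdsWithin] with h hh
  rw [integral_prod]
  exact (hint.const_mul 16).mono' (measurable_scaledKernel A h).aestronglyMeasurable (hbd hh)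

lemma intervalIntegral_neg_one_one_eq_add {f : ℝ → ℝ} (hf : IntervalIntegrable f volume (-1) 1) :
    ∫ y in (-1 : ℝ)..1, f y = ∫ y in Set.Ioo (0 : ℝ) 1, (f y + f (-y)) := by
  have h1 : IntervalIntegrable f volume (-1) 0 :=
    hf.mono_set (Set.uIcc_subset_uIcc (by simp) (by simp))
  have h2 : IntervalIntegrable f volume 0 1 :=
    hf.mono_set (Set.uIcc_subset_uIcc (by simp) (by simp))
  have h3 : IntervalIntegrable (fun y => f (-y)) volume 0 1 := by
    have := ((IntervalIntegrable.iff_comp_neg (f := f)).1 h1).symm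
    simpa using this
  rw [← integral_Ioc_eq_integral_Ioo, ← intervalIntegral.integral_of_le zero_le_one,
    intervalIntegral.integral_add h2 h3, intervalIntegral.integral_comp_neg (fun y => f y),
    neg_zero, add_comm, intervalIntegral.integral_add_adjacent_intervals h1 h2]

lemma intervalIntegral_neg_one_one_of_even {f : ℝ → ℝ} (hf : ∀ x, f (-x) = f x) :
    ∫ x in (-1 : ℝ)..1, f x = 2 * ∫ x in Set.Ioo (0 : ℝ) 1, f x := by
  have h1 : ∀ x, (Set.Ioo (-1 : ℝ) 1).indicator f x = (Set.Iio (1 : ℝ)).indicator f |x| := by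
    intro x
    have habs : f |x| = f x := by rcases abs_choice x with h | h <;> rw [h]; exact hf x
    simp only [Set.indicator, Set.mem_Ioo, Set.mem_Iio, abs_lt, habs]
  rw [intervalIntegral.integral_of_le (by norm_num), integral_Ioc_eq_integral_Ioo,
    ← integral_indicator measurableSet_Ioo]
  simp_rw [h1]
  rw [integral_comp_abs, setIntegral_indicator measurableSet_Iio, Set.Ioi_inter_Iio]

lemma setIntegral_Ioo_eq_integral_exp {h : ℝ} (hh : 0 < h) (f : ℝ → ℝ) :
    ∫ x in Set.Ioo (0 : ℝ) 1, f x =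
      ∫ s in Set.Ioi (0 : ℝ), h / 2 * Real.exp (-(h * s / 2)) * f (Real.exp (-(h * s / 2))) := by
  have himg : (fun s => Real.exp (-(h * s / 2))) '' Set.Ioi 0 = Set.Ioo 0 1 := by
    ext x
    simp only [Set.mem_image, Set.mem_Ioi, Set.mem_Ioo]
    constructor
    · rintro ⟨s, hs, rfl⟩
      refine ⟨Real.exp_pos _, Real.exp_lt_one_iff.2 ?_⟩
      have := mul_pos hh hs
      linarith
    · rintro ⟨h0, h1⟩
      refine ⟨-(2 * Real.log x / h), ?_, ?_⟩
      · have := Real.log_neg h0 h1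
        rw [neg_pos]
        exact div_neg_of_neg_of_pos (by linarith) hh
      · rw [show -(h * -(2 * Real.log x / h) / 2) = Real.log x by field_simp, Real.exp_log h0]
  have hder : ∀ s ∈ Set.Ioi (0 : ℝ), HasDerivWithinAt (fun s => Real.exp (-(h * s / 2)))
      (-(h / 2 * Real.exp (-(h * s / 2)))) (Set.Ioi 0) s := by
    intro s _
    have := ((((hasDerivAt_id s).const_mul h).div_const 2).neg.exp).hasDerivWithinAt
      (s := Set.Ioi 0)
    refine this.congr_deriv ?_
    simp only [Pi.neg_apply, id_eq, mul_one]
    ring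
  have hinj : Set.InjOn (fun s => Real.exp (-(h * s / 2))) (Set.Ioi 0) := by
    intro a _ b _ hab
    have hab := Real.exp_injective hab
    exact mul_left_cancel₀ hh.ne' (by linarith)
  rw [← himg, integral_image_eq_integral_abs_deriv_smul measurableSet_Ioi hder hinj]
  refine setIntegral_congr_fun measurableSet_Ioi fun s _ => ?_
  rw [abs_neg, abs_of_pos (by positivity), smul_eq_mul]

/-- The integrand of `Gam` for the monomials of degrees `m` and `n`. -/
def monomialKernel (m n : ℕ) (x y : ℝ) : ℝ :=
  ((x ^ m - y ^ m) / (x - y)) * ((x ^ n - y ^ n) / (x - y)) *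
    ((1 - x * y) / (√(1 - x ^ 2) * √(1 - y ^ 2)))

lemma monomialKernel_neg_neg {m n : ℕ} (hm : Even m) (hn : Even n) (x y : ℝ) :
    monomialKernel m n (-x) (-y) = monomialKernel m n x y := by
  unfold monomialKernel
  rw [hm.neg_pow, hm.neg_pow, hn.neg_pow, hn.neg_pow, neg_mul_neg, neg_sq, neg_sq,
    show -x - -y = -(x - y) by ring, div_neg, div_neg, neg_mul_neg]

lemma abs_pow_sub_pow_div_le (m : ℕ) {x y : ℝ} (hx : |x| ≤ 1) (hy : |y| ≤ 1) :
    |(x ^ m - y ^ m) / (x - y)| ≤ m := by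
  rw [abs_div]
  refine div_le_of_le_mul₀ (abs_nonneg _) (Nat.cast_nonneg _) ?_
  calc |x ^ m - y ^ m| ≤ |x - y| * m * max |x| |y| ^ (m - 1) := abs_pow_sub_pow_le ..
    _ ≤ |x - y| * m * 1 := by
        gcongr
        exact pow_le_one₀ (by positivity) (max_le hx hy)
    _ = _ := by ring

lemma intervalIntegrable_monomialKernel (m n : ℕ) {x : ℝ} (hx : |x| ≤ 1) :
    IntervalIntegrable (monomialKernel m n x) volume (-1) 1 := by
  have h1 := Polynomial.Chebyshev.intervalIntegrable_sqrt_one_sub_sq_inv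
  refine (h1.const_mul (m * n * (2 / √(1 - x ^ 2)))).mono_fun
    (Measurable.aestronglyMeasurable (by unfold monomialKernel; fun_prop)) ?_
  rw [Set.uIoc_of_le (by norm_num)]
  filter_upwards [ae_restrict_mem measurableSet_Ioc] with y hy
  have hy' : |y| ≤ 1 := abs_le.2 ⟨hy.1.le, hy.2⟩
  have hxy : |1 - x * y| ≤ 2 := by
    have : |x * y| ≤ 1 := by rw [abs_mul]; exact mul_le_one₀ hx (abs_nonneg _) hy'
    rw [abs_le] at this ⊢
    constructor <;> linarith
  rw [Real.norm_eq_abs, Real.norm_eq_abs, monomialKernel, abs_mul, abs_mul,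
    abs_of_nonneg (show 0 ≤ (m : ℝ) * n * (2 / √(1 - x ^ 2)) * √(1 - y ^ 2)⁻¹ by positivity),
    abs_div (1 - x * y), abs_of_nonneg (show 0 ≤ √(1 - x ^ 2) * √(1 - y ^ 2) by positivity)]
  calc _ ≤ (m : ℝ) * n * (2 / (√(1 - x ^ 2) * √(1 - y ^ 2))) := by
        gcongr
        · exact abs_pow_sub_pow_div_le m hx hy'
        · exact abs_pow_sub_pow_div_le n hx hy'
    _ = _ := by rw [Real.sqrt_inv, mul_assoc _ (2 / _), div_mul_eq_div_mul_one_div, one_div]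

lemma monomialKernel_add_neg {m n : ℕ} (hm : Even m) (hn : Even n) {x y : ℝ} (hx : 0 < x)
    (hy : 0 < y) : monomialKernel m n x y + monomialKernel m n x (-y) =
      (x ^ m - y ^ m) * (x ^ n - y ^ n) * (2 * (x ^ 2 + y ^ 2 - 2 * x ^ 2 * y ^ 2) /
        ((x ^ 2 - y ^ 2) ^ 2 * (√(1 - x ^ 2) * √(1 - y ^ 2)))) := by
  unfold monomialKernel
  rw [hm.neg_pow, hn.neg_pow, neg_sq, sub_neg_eq_add]
  rcases eq_or_ne x y with rfl | hne
  · simp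
  have h1 : x - y ≠ 0 := sub_ne_zero.2 hne
  have h2 : x + y ≠ 0 := by positivity
  have h3 : x ^ 2 + y ^ 2 - 2 * x ^ 2 * y ^ 2 =
    ((1 - x * y) * (x + y) ^ 2 + (1 + x * y) * (x - y) ^ 2) / 2 := by ring
  rw [show x ^ 2 - y ^ 2 = (x + y) * (x - y) by ring, h3]
  generalize √(1 - x ^ 2) * √(1 - y ^ 2) = r
  rw [mul_neg, sub_neg_eq_add]
  generalize x - y = d at *
  generalize x + y = e at *
  generalize x * y = c at *
  by_cases hr : r = 0
  · simp [hr]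
  field_simp

lemma Gam_pow_eq {A k : ℕ} (hk : 0 < k) :
    Gam (fun x => x ^ (2 * k)) (fun x => x ^ (2 * A * k)) = (1 / Real.pi ^ 2) *
      ∫ s in Set.Ioi (0 : ℝ), ∫ t in Set.Ioi (0 : ℝ), scaledKernel A ((k : ℝ)⁻¹) s t := by
  have hm : Even (2 * k) := even_two_mul k
  have hn : Even (2 * A * k) := by rw [mul_assoc]; exact even_two_mul _
  have hk' : (0 : ℝ) < k := Nat.cast_pos.2 hk
  have hh : (0 : ℝ) < (k : ℝ)⁻¹ := inv_pos.2 hk'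
  change (1 / Real.pi ^ 2) * ∫ x in (-1 : ℝ)..1, ∫ y in (-1 : ℝ)..1,
    monomialKernel (2 * k) (2 * A * k) x y = _
  congr 1
  have heven (x : ℝ) : ∫ y in (-1 : ℝ)..1, monomialKernel (2 * k) (2 * A * k) (-x) y =
      ∫ y in (-1 : ℝ)..1, monomialKernel (2 * k) (2 * A * k) x y := by
    have := intervalIntegral.integral_comp_neg (a := -1) (b := 1)
      (fun y => monomialKernel (2 * k) (2 * A * k) (-x) y)
    simp only [monomialKernel_neg_neg hm hn, neg_neg] at this
    exact this.symm
  rw [intervalIntegral_neg_one_one_of_even heven, setIntegral_Ioo_eq_integral_exp hh,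
    ← integral_const_mul]
  refine setIntegral_congr_fun measurableSet_Ioi fun s hs => ?_
  have hs : 0 < s := hs
  have hx : |Real.exp (-((k : ℝ)⁻¹ * s / 2))| ≤ 1 := by
    rw [abs_of_pos (Real.exp_pos _), Real.exp_le_one_iff, neg_nonpos]
    positivity
  rw [intervalIntegral_neg_one_one_eq_add (intervalIntegrable_monomialKernel _ _ hx),
    setIntegral_Ioo_eq_integral_exp hh, ← integral_const_mul, ← integral_const_mul]
  refine setIntegral_congr_fun measurableSet_Ioi fun t _ => ?_
  rw [monomialKernel_add_neg hm hn (Real.exp_pos _) (Real.exp_pos _)]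
  have e1 (r : ℝ) : Real.exp (-((k : ℝ)⁻¹ * r / 2)) ^ (2 * k) = Real.exp (-r) := by
    rw [← Real.exp_nat_mul]; congr 1; push_cast; field_simp
  have e2 (r : ℝ) : Real.exp (-((k : ℝ)⁻¹ * r / 2)) ^ (2 * A * k) = Real.exp (-(A * r)) := by
    rw [← Real.exp_nat_mul]; congr 1; push_cast; field_simp
  have e3 (r : ℝ) : Real.exp (-((k : ℝ)⁻¹ * r / 2)) ^ 2 = Real.exp (-((k : ℝ)⁻¹ * r)) := by
    rw [← Real.exp_nat_mul]; congr 1; push_cast; ring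
  have e4 : Real.exp (-(((k : ℝ)⁻¹ * s + (k : ℝ)⁻¹ * t) / 2)) =
      Real.exp (-((k : ℝ)⁻¹ * s / 2)) * Real.exp (-((k : ℝ)⁻¹ * t / 2)) := by
    rw [← Real.exp_add]; congr 1; ring
  rw [e1, e1, e2, e2, e3, e3, scaledKernel, expWeight, e4]
  ring

/-- Lemma 6.5 of the paper: for a fixed positive integer `A` and `p_r(x) = x^r`,
`Γ(p_{2k}, p_{2Ak})` converges, as `k → ∞` over positive integers, to
`(1/π²) ∫₀^∞ ∫₀^∞ ((e^{−s} − e^{−t})/(s − t)) ((e^{−As} − e^{−At})/(s − t)) (s + t)/√(st) ds dt`. -/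
theorem Gam_limit_integral (A : ℕ) (hA : 0 < A) :
    Tendsto
      (fun k : ℕ => Gam (fun x => x ^ (2 * k)) (fun x => x ^ (2 * A * k)))
      atTop
      (𝓝 ((1 / Real.pi ^ 2) *
        ∫ s in Set.Ioi (0 : ℝ), ∫ t in Set.Ioi (0 : ℝ), limitKernel (A : ℝ) s t)) := by
  have hA' : (1 : ℝ) ≤ A := Nat.one_le_cast.2 hA
  have hlim : Tendsto (fun k : ℕ => (k : ℝ)⁻¹) atTop (𝓝[>] 0) :=
    tendsto_inv_atTop_nhdsGT_zero.comp tendsto_natCast_atTop_atTop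
  refine (((tendsto_integral_scaledKernel hA').comp hlim).const_mul (1 / Real.pi ^ 2)).congr' ?_
  filter_upwards [eventually_gt_atTop 0] with k hk
  exact (Gam_pow_eq hk).symm
end
end
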